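/- Let F₀ be a number field with [F₀:ℚ] = n and σ : F₀ → F₀ a ℚ-algebra automorphism with σ ≠ id such that ρ(σ(a)) = conj(ρ(a)) for every ring embedding ρ : F₀ → ℂ (so F₀ is a CM field). Let V be an F₀-vector space with dim_{F₀} V = 2, equipped with a symmetric positive definite ℚ-bilinear form B (on V as ℚ-vector space) satisfying B(a•x, y) = B(x, σ(a)•y) for all a ∈ F₀. Let W ⊆ V_ℂ be an n-dimensional ℂ-subspace, isotropic for B_ℂ, stable under a ⊗ 1 for every a ∈ F₀, and such that for every embedding τ : F₀ → ℂ, dim_ℂ (W ∩ V_τ) = 1. Then there exist an additive map ψ : V → V and an element c ∈ F₀ with σ(c) = c and ρ(c) < 0 for every embedding ρ : F₀ → ℂ, such that ψ(a•x) = σ(a)•ψ(x) for all a ∈ F₀ and x ∈ V, ψ∘ψ equals multiplication by c on V, and (ψ ⊗ id_ℂ)(W) ⊆ W. -/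

import Mathlib

open TensorProduct

/-- The action of `a ∈ K` on `ℂ ⊗[ℚ] V`, i.e. `a ⊗ 1`. -/
noncomputable def actionC (K V : Type*) [Field K] [Algebra ℚ K] [AddCommGroup V]
    [Module ℚ V] [Module K V] [IsScalarTower ℚ K V] (a : K) :
    (ℂ ⊗[ℚ] V) →ₗ[ℂ] (ℂ ⊗[ℚ] V) :=
  LinearMap.baseChange ℂ ((LinearMap.lsmul K V a).restrictScalars ℚ)

/-- The eigenspace `V_τ = {v ∈ V_ℂ : (a ⊗ 1) v = τ(a) • v for all a ∈ K}` attached to an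
embedding `τ : K → ℂ`. -/
noncomputable def eigenspaceC (K V : Type*) [Field K] [Algebra ℚ K] [AddCommGroup V]
    [Module ℚ V] [Module K V] [IsScalarTower ℚ K V] (τ : K →+* ℂ) :
    Submodule ℂ (ℂ ⊗[ℚ] V) where
  carrier := {v | ∀ a : K, actionC K V a v = τ a • v}
  add_mem' := by
    intro x y hx hy a
    simp [map_add, hx a, hy a, smul_add]
  zero_mem' := by
    intro a
    simp
  smul_mem' := by
    intro z v hv a
    rw [map_smul, hv a, smul_comm]

section

open Module

/-- The complex embeddings of a number field are separated by a single element. -/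
theorem NumberField.exists_injective_embedding_apply (K : Type*) [Field K] [NumberField K] :
    ∃ α : K, Function.Injective fun τ : K →+* ℂ => τ α := by
  let pb := Field.powerBasisOfFiniteOfSeparable ℚ K
  refine ⟨pb.gen, fun τ τ' h => (RingHom.equivRatAlgHom K ℂ).injective (pb.algHom_ext ?_)⟩
  exact h

/-- The trace of an element of a number field is the sum of its complex conjugates. -/
theorem NumberField.trace_eq_sum_ringHom {K : Type*} [Field K] [NumberField K] (x : K) :
    ((Algebra.trace ℚ K x : ℚ) : ℂ) = ∑ τ : K →+* ℂ, τ x := by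
  rw [← eq_ratCast (algebraMap ℚ ℂ), trace_eq_sum_embeddings ℂ]
  exact (Fintype.sum_equiv (RingHom.equivRatAlgHom K ℂ) _ _ fun _ => rfl).symm

/-- Every linear functional on a finite separable extension is of the form `a ↦ Tr (a * d)`. -/
theorem Algebra.exists_trace_mul_eq {k K : Type*} [Field k] [Field K] [Algebra k K]
    [FiniteDimensional k K] [Algebra.IsSeparable k K] (φ : K →ₗ[k] k) :
    ∃ d : K, ∀ a, φ a = Algebra.trace k K (a * d) := by
  refine ⟨((Algebra.traceForm k K).toDual (traceForm_nondegenerate k K)).symm φ, fun a => ?_⟩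
  have := LinearMap.BilinForm.apply_toDual_symm_apply (hB := traceForm_nondegenerate k K) φ a
  rw [← this, Algebra.traceForm_apply, mul_comm]

/-- If `a ↦ Tr (a * σ a * d)` is positive definite, where `σ` induces complex conjugation at every
embedding and fixes `d`, then `d` is totally positive. -/
theorem NumberField.re_pos_of_trace_mul_conj_pos {K : Type*} [Field K] [NumberField K]
    (σ : K ≃ₐ[ℚ] K) (hσ : ∀ (ρ : K →+* ℂ) (a : K), ρ (σ a) = starRingEnd ℂ (ρ a))
    {d : K} (hd : σ d = d)
    (hpos : ∀ a : K, a ≠ 0 → 0 < Algebra.trace ℚ K (a * σ a * d)) (ρ : K →+* ℂ) :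
    0 < (ρ d).re ∧ (ρ d).im = 0 := by
  classical
  have him (τ : K →+* ℂ) : (τ d).im = 0 := Complex.conj_eq_iff_im.mp (by rw [← hσ, hd])
  refine ⟨?_, him ρ⟩
  have hd0 : d ≠ 0 := by
    rintro rfl
    simpa using hpos 1 one_ne_zero
  have hne : (ρ d).re ≠ 0 := fun h => hd0 <| (map_eq_zero ρ).mp <| Complex.ext h (him ρ)
  by_contra hneg
  have hlt : (ρ d).re < 0 := lt_of_le_of_ne (not_lt.mp hneg) hne
  obtain ⟨a, ha1, ha⟩ := AbsoluteValue.exists_one_lt_lt_one_pi_of_not_isEquiv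
    (v := fun v : InfinitePlace K => v.1) (fun v => v.isNontrivial)
    (fun _ _ h => InfinitePlace.eq_iff_isEquiv.not.mp h) (InfinitePlace.mk ρ)
  replace ha1 : 1 < ‖ρ a‖ := ha1
  have ha0 : a ≠ 0 := by
    rintro rfl
    norm_num at ha1
  have hsum (k : ℕ) :
      (Algebra.trace ℚ K (a ^ k * σ (a ^ k) * d) : ℝ) =
        ∑ τ : K →+* ℂ, (‖τ a‖ ^ 2) ^ k * (τ d).re := by
    have h := congrArg Complex.re (NumberField.trace_eq_sum_ringHom (a ^ k * σ (a ^ k) * d))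
    rw [Complex.ratCast_re, Complex.re_sum] at h
    rw [h]
    refine Finset.sum_congr rfl fun τ _ => ?_
    rw [map_mul, map_mul, hσ, Complex.mul_conj, Complex.normSq_eq_norm_sq, Complex.re_ofReal_mul,
      map_pow, norm_pow]
    ring
  have hbound (k : ℕ) (τ : K →+* ℂ) :
      (‖τ a‖ ^ 2) ^ k * (τ d).re ≤
        |(τ d).re| + if τ = ρ then (‖ρ a‖ ^ 2) ^ k * (ρ d).re else 0 := by
    by_cases hτ : InfinitePlace.mk τ = InfinitePlace.mk ρ
    · have hre : (τ d).re = (ρ d).re := by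
        rcases InfinitePlace.mk_eq_iff.mp hτ with rfl | h
        · rfl
        · rw [← h, ComplexEmbedding.conjugate_coe_eq, Complex.conj_re]
      have h0 : (‖τ a‖ ^ 2) ^ k * (τ d).re ≤ 0 :=
        mul_nonpos_of_nonneg_of_nonpos (by positivity) (hre ▸ hlt.le)
      split_ifs with h
      · subst h
        linarith [abs_nonneg (τ d).re]
      · linarith [abs_nonneg (τ d).re]
    · have hτρ : τ ≠ ρ := fun h => hτ (h ▸ rfl)
      rw [if_neg hτρ, add_zero]
      have h1 : ‖τ a‖ < 1 := ha _ hτ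
      have h2 : (‖τ a‖ ^ 2) ^ k ≤ 1 :=
        pow_le_one₀ (by positivity) (pow_le_one₀ (norm_nonneg _) h1.le)
      calc (‖τ a‖ ^ 2) ^ k * (τ d).re ≤ (‖τ a‖ ^ 2) ^ k * |(τ d).re| := by
            gcongr
            exact le_abs_self _
        _ ≤ 1 * |(τ d).re| := by gcongr
        _ = |(τ d).re| := one_mul _
  obtain ⟨k, hk⟩ := pow_unbounded_of_one_lt ((∑ τ : K →+* ℂ, |(τ d).re|) / -(ρ d).re)
    (one_lt_pow₀ ha1 two_ne_zero)
  rw [div_lt_iff₀ (by linarith)] at hk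
  have hp : (0 : ℝ) < Algebra.trace ℚ K (a ^ k * σ (a ^ k) * d) := by
    exact_mod_cast hpos (a ^ k) (pow_ne_zero k ha0)
  rw [hsum k] at hp
  have hle := Finset.sum_le_sum fun τ (_ : τ ∈ Finset.univ) => hbound k τ
  rw [Finset.sum_add_distrib, Finset.sum_ite_eq' Finset.univ ρ, if_pos (Finset.mem_univ _)] at hle
  linarith

/-- Nondegeneracy of a bilinear form is preserved by extension of the base field. -/
theorem LinearMap.BilinForm.Nondegenerate.baseChange {k L V : Type*} [Field k] [Field L]
    [Algebra k L] [AddCommGroup V] [Module k V] [FiniteDimensional k V]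
    {B : LinearMap.BilinForm k V} (hB : B.Nondegenerate) :
    (B.baseChange L).Nondegenerate := by
  classical
  let b := Module.finBasis k V
  have hmat : BilinForm.toMatrix (b.baseChange L) (B.baseChange L) =
      (BilinForm.toMatrix b B).map (algebraMap k L) := by
    ext i j
    simp [BilinForm.toMatrix_apply, Algebra.algebraMap_eq_smul_one]
  rw [← BilinForm.nondegenerate_toMatrix_iff b, Matrix.nondegenerate_iff_det_ne_zero] at hB
  rw [← BilinForm.nondegenerate_toMatrix_iff (b.baseChange L),
    Matrix.nondegenerate_iff_det_ne_zero, hmat, ← RingHom.mapMatrix_apply, ← RingHom.map_det]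
  exact (map_ne_zero _).mpr hB

/-- A plane over `K` with a definite bilinear form over a subfield `k` has a `K`-basis whose two
lines are orthogonal to each other. -/
theorem LinearMap.BilinForm.exists_basis_forall_smul_eq_zero {k K V : Type*} [Field k] [Field K]
    [Algebra k K] [FiniteDimensional k K] [AddCommGroup V] [Module k V] [Module K V]
    [IsScalarTower k K V] (hdim : finrank K V = 2) {B : LinearMap.BilinForm k V}
    (hB : B.Nondegenerate) (hdef : ∀ x, x ≠ 0 → B x x ≠ 0) :
    ∃ b : Basis (Fin 2) K V, ∀ a : K, B (a • b 0) (b 1) = 0 := by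
  have : FiniteDimensional K V := FiniteDimensional.of_finrank_pos (by omega)
  have : FiniteDimensional k V := FiniteDimensional.trans k K V
  have : Nontrivial V := Module.nontrivial_of_finrank_pos (R := K) (by omega)
  obtain ⟨e, he⟩ := exists_ne (0 : V)
  let L : Submodule k V := (Submodule.span K {e}).restrictScalars k
  have hL : finrank k L = finrank k K := by
    have h := finrank_mul_finrank k K (Submodule.span K {e})
    rw [finrank_span_singleton he, mul_one] at h
    exact h.symm
  have hperp : 0 < finrank k (B.orthogonal L) := by
    have h := finrank_mul_finrank k K V
    have h0 : 0 < finrank k K := finrank_pos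
    rw [hdim] at h
    rw [finrank_orthogonal hB, hL]
    omega
  have := Module.nontrivial_of_finrank_pos hperp
  obtain ⟨⟨f, hf⟩, hf0⟩ := exists_ne (0 : B.orthogonal L)
  replace hf0 : f ≠ 0 := fun h => hf0 (Subtype.ext h)
  have horth (a : K) : B (a • e) f = 0 :=
    hf _ (Submodule.smul_mem _ a (Submodule.mem_span_singleton_self e))
  have hli : LinearIndependent K ![e, f] := by
    rw [LinearIndependent.pair_iff' he]
    rintro a rfl
    exact hdef _ hf0 (horth a)
  refine ⟨basisOfLinearIndependentOfCardEqFinrank hli (by simp [hdim]), fun a => ?_⟩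
  simpa using horth a

/-- A plane over a CM field with a positive definite Hermitian-compatible rational form carries a
conjugate-linear map `ψ`, alternating for the form, whose square is totally negative. -/
theorem NumberField.exists_conjLinear_alternating {K V : Type*} [Field K] [NumberField K]
    (σ : K ≃ₐ[ℚ] K) (hσ : ∀ (ρ : K →+* ℂ) (a : K), ρ (σ a) = starRingEnd ℂ (ρ a))
    [AddCommGroup V] [Module ℚ V] [Module K V] [IsScalarTower ℚ K V]
    (hdim : finrank K V = 2) {B : LinearMap.BilinForm ℚ V} (hB : B.Nondegenerate)
    (hsymm : ∀ x y : V, B x y = B y x) (hpos : ∀ x : V, x ≠ 0 → 0 < B x x)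
    (hcompat : ∀ (a : K) (x y : V), B (a • x) y = B x (σ a • y)) :
    ∃ (ψ : V →ₗ[ℚ] V) (c : K), σ c = c ∧ (∀ ρ : K →+* ℂ, (ρ c).re < 0 ∧ (ρ c).im = 0) ∧
      (∀ (a : K) (x : V), ψ (a • x) = σ a • ψ x) ∧ (∀ x, ψ (ψ x) = c • x) ∧
      ∀ x, B (ψ x) x = 0 := by
  obtain ⟨b, hb⟩ := LinearMap.BilinForm.exists_basis_forall_smul_eq_zero hdim hB
    fun x hx => (hpos x hx).ne'
  have hσσ (a : K) : σ (σ a) = a := by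
    obtain ⟨ρ⟩ : Nonempty (K →+* ℂ) := inferInstance
    apply ρ.injective
    rw [hσ, hσ, Complex.conj_conj]
  have hright (a : K) (x y : V) : B x (a • y) = B (σ a • x) y := by
    rw [hcompat, hσσ]
  choose d hd using fun i => Algebra.exists_trace_mul_eq
    ((B.flip (b i)) ∘ₗ (LinearMap.toSpanSingleton K V (b i)).restrictScalars ℚ)
  replace hd (i : Fin 2) (a : K) : B (a • b i) (b i) = Algebra.trace ℚ K (a * d i) := by
    simpa using hd i a
  have hσd (i : Fin 2) : σ (d i) = d i := by
    rw [← sub_eq_zero]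
    refine (traceForm_nondegenerate ℚ K).1 _ fun a => ?_
    have h1 : Algebra.trace ℚ K (σ (σ a * d i)) = Algebra.trace ℚ K (σ a * d i) :=
      Algebra.trace_eq_of_algEquiv σ _
    rw [map_mul, hσσ, ← hd, hcompat, hσσ, hsymm, hd] at h1
    rw [Algebra.traceForm_apply, sub_mul, map_sub, mul_comm, h1, mul_comm, sub_self]
  have hdpos (i : Fin 2) := re_pos_of_trace_mul_conj_pos σ hσ (hσd i) fun a ha => by
    rw [mul_comm a, ← hd, mul_smul, ← hright]
    exact hpos _ (smul_ne_zero ha (b.ne_zero i))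
  let ψ : V →ₗ[ℚ] V := AddMonoidHom.toRatLinearMap <| AddMonoidHom.mk'
    (fun x => (-(d 1 * σ (b.repr x 1))) • b 0 + (d 0 * σ (b.repr x 0)) • b 1) fun x y => by
      simp only [map_add, Finsupp.add_apply]
      module
  have hψ (x : V) :
    ψ x = (-(d 1 * σ (b.repr x 1))) • b 0 + (d 0 * σ (b.repr x 0)) • b 1 := rfl
  have hexp (x : V) : x = b.repr x 0 • b 0 + b.repr x 1 • b 1 := by
    conv_lhs => rw [← b.sum_repr x, Fin.sum_univ_two]
  refine ⟨ψ, -(d 0 * d 1), ?_, fun ρ => ?_, fun a x => ?_, fun x => ?_, fun x => ?_⟩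
  · rw [map_neg, map_mul, hσd, hσd]
  · obtain ⟨h0, h0'⟩ := hdpos 0 ρ
    obtain ⟨h1, h1'⟩ := hdpos 1 ρ
    simp only [map_neg, map_mul, Complex.neg_re, Complex.mul_re, Complex.neg_im, Complex.mul_im,
      h0', h1']
    constructor
    · have := mul_pos h0 h1
      linarith
    · ring
  · simp only [hψ, map_smul, Finsupp.smul_apply, smul_eq_mul, map_mul]
    module
  · conv_rhs => rw [hexp x]
    rw [hψ (ψ x), hψ x]
    simp [hσσ, hσd]
    module
  · have h01 (a c : K) : B (a • b 0) (c • b 1) = 0 := by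
      rw [hright, smul_smul, hb]
    have h10 (a c : K) : B (a • b 1) (c • b 0) = 0 := by
      rw [hsymm, h01]
    have hii (i : Fin 2) (a c : K) :
        B (a • b i) (c • b i) = Algebra.trace ℚ K (σ c * a * d i) := by
      rw [hright, smul_smul, hd]
    conv_lhs => rw [hψ x]; arg 2; rw [hexp x]
    simp only [map_add, LinearMap.add_apply, h01, h10, hii]
    rw [add_zero, zero_add, ← map_add, ← map_zero (Algebra.trace ℚ K)]
    congr 1
    ring

/-- A rational endomorphism `ψ` which is conjugate-linear and alternating for `B` preserves every
`B`-isotropic subspace that has half the dimension and meets each eigenspace in a line. -/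
theorem baseChange_mem_of_conjLinear_alternating {K V : Type*} [Field K] [NumberField K]
    (σ : K ≃ₐ[ℚ] K) [AddCommGroup V] [Module ℚ V] [Module K V] [IsScalarTower ℚ K V]
    (hdim : finrank K V = 2) {B : LinearMap.BilinForm ℚ V} (hB : B.Nondegenerate)
    (hsymm : ∀ x y : V, B x y = B y x)
    (hcompat : ∀ (a : K) (x y : V), B (a • x) y = B x (σ a • y))
    {W : Submodule ℂ (ℂ ⊗[ℚ] V)} (hWdim : finrank ℂ W = finrank ℚ K)
    (hisot : ∀ x ∈ W, ∀ y ∈ W, B.baseChange ℂ x y = 0)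
    (htype : ∀ τ : K →+* ℂ, finrank ℂ ↥(W ⊓ eigenspaceC K V τ) = 1)
    {ψ : V →ₗ[ℚ] V} (hσσ : ∀ a, σ (σ a) = a) (hψ : ∀ (a : K) (x : V), ψ (a • x) = σ a • ψ x)
    (halt : ∀ x, B (ψ x) x = 0) {w : ℂ ⊗[ℚ] V} (hw : w ∈ W) :
    ψ.baseChange ℂ w ∈ W := by
  have : FiniteDimensional K V := FiniteDimensional.of_finrank_pos (by omega)
  have : FiniteDimensional ℚ V := FiniteDimensional.trans ℚ K V
  let A : LinearMap.BilinForm ℚ V := B ∘ₗ ψ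
  have hA (x y : ℂ ⊗[ℚ] V) : A.baseChange ℂ x y = B.baseChange ℂ (ψ.baseChange ℂ x) y := by
    induction x with
    | zero => simp
    | add x x' hx hx' => simp [hx, hx']
    | tmul z x =>
      induction y with
      | zero => simp
      | add y y' hy hy' => simp only [map_add, hy, hy']
      | tmul z' y => simp [A]
  have hAself (x : ℂ ⊗[ℚ] V) : A.baseChange ℂ x x = 0 := by
    have hskew (x y : ℂ ⊗[ℚ] V) : A.baseChange ℂ x y = -A.baseChange ℂ y x := by
      have hAalt : A.IsAlt := halt
      induction x with
      | zero => simp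
      | add x x' hx hx' => simp only [map_add, LinearMap.add_apply, hx, hx', neg_add]
      | tmul z x =>
        induction y with
        | zero => simp
        | add y y' hy hy' => simp only [map_add, LinearMap.add_apply, hy, hy', neg_add]
        | tmul z' y => simp [← hAalt.neg_eq y x, mul_comm z z']
    exact self_eq_neg.mp (hskew x x)
  have hAaction (a : K) (x y : ℂ ⊗[ℚ] V) :
      A.baseChange ℂ (actionC K V a x) y = A.baseChange ℂ x (actionC K V a y) := by
    induction x with
    | zero => simp
    | add x x' hx hx' => simp only [map_add, LinearMap.add_apply, hx, hx']
    | tmul z x =>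
      induction y with
      | zero => simp
      | add y y' hy hy' => simp only [map_add, hy, hy']
      | tmul z' y => simp [actionC, A, hψ, hcompat, hσσ]
  obtain ⟨α, hα⟩ := NumberField.exists_injective_embedding_apply K
  have hline (τ : K →+* ℂ) : ∃ v ∈ W ⊓ eigenspaceC K V τ, v ≠ 0 := by
    refine Submodule.exists_mem_ne_zero_of_ne_bot fun h => ?_
    have := htype τ
    rw [h, finrank_bot] at this
    exact zero_ne_one this
  choose v hv hv0 using hline
  have hli : LinearIndependent ℂ v :=
    Module.End.eigenvectors_linearIndependent' (actionC K V α) _ hα v fun τ =>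
      ⟨Module.End.mem_eigenspace_iff.mpr ((hv τ).2 α), hv0 τ⟩
  have hspan : Submodule.span ℂ (Set.range v) = W := by
    refine Submodule.eq_of_le_of_finrank_eq
      (Submodule.span_le.mpr (Set.range_subset_iff.mpr fun τ => (hv τ).1)) ?_
    rw [finrank_span_eq_card hli, hWdim, NumberField.Embeddings.card]
  have hAv (τ τ' : K →+* ℂ) : A.baseChange ℂ (v τ) (v τ') = 0 := by
    by_cases h : τ = τ'
    · rw [h, hAself]
    · have := hAaction α (v τ) (v τ')
      rw [(hv τ).2 α, (hv τ').2 α, map_smul, map_smul, LinearMap.smul_apply, smul_eq_mul,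
        smul_eq_mul] at this
      exact (mul_eq_mul_right_iff.mp this).resolve_left (hα.ne h)
  have hAW {x y : ℂ ⊗[ℚ] V} (hx : x ∈ W) (hy : y ∈ W) : A.baseChange ℂ x y = 0 := by
    rw [← hspan] at hx hy
    induction hx, hy using Submodule.span_induction₂ with
    | mem_mem x y hx hy =>
      obtain ⟨τ, rfl⟩ := hx
      obtain ⟨τ', rfl⟩ := hy
      exact hAv τ τ'
    | zero_left => simp
    | zero_right => simp
    | add_left _ _ _ _ _ _ h h' => simp [h, h']
    | add_right _ _ _ _ _ _ h h' => simp [h, h']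
    | smul_left _ _ _ _ _ h => simp [h]
    | smul_right _ _ _ _ _ h => simp [h]
  have hBsymm : LinearMap.IsSymm (B.baseChange ℂ) :=
    LinearMap.BilinForm.IsSymm.baseChange ℂ ⟨hsymm⟩
  have hWorth : W = (B.baseChange ℂ).orthogonal W := by
    refine Submodule.eq_of_le_of_finrank_eq (fun x hx y hy => hisot y hy x hx) ?_
    have h := finrank_mul_finrank ℚ K V
    rw [hdim] at h
    rw [LinearMap.BilinForm.finrank_orthogonal hB.baseChange, finrank_baseChange, hWdim]
    omega
  rw [hWorth]
  intro y hy
  change B.baseChange ℂ y (ψ.baseChange ℂ w) = 0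
  rw [← hBsymm.eq, RingHom.id_apply, ← hA]
  exact hAW hw hy

end

/-- A Hodge structure of type `(n,0,n)` with endomorphisms by a CM field
`F₀` of degree `n` whose `F₀`-Hodge type is `(1,0,1)` at every embedding has an extra
`σ`-semilinear endomorphism `ψ` with `ψ² = c` for a totally negative `c ∈ F` (generating
a totally definite quaternion algebra over the totally real subfield `F = F₀^σ`). -/
theorem cm_degree_n_extra_endomorphism
    (F₀ : Type*) [Field F₀] [NumberField F₀] (n : ℕ)
    (hdeg : Module.finrank ℚ F₀ = n)
    (σ : F₀ ≃ₐ[ℚ] F₀) (hσne : σ ≠ AlgEquiv.refl)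
    (hσ : ∀ (ρ : F₀ →+* ℂ) (a : F₀), ρ (σ a) = (starRingEnd ℂ) (ρ a))
    (V : Type*) [AddCommGroup V] [Module ℚ V] [Module F₀ V] [IsScalarTower ℚ F₀ V]
    [FiniteDimensional F₀ V] (hdimV : Module.finrank F₀ V = 2)
    (B : LinearMap.BilinForm ℚ V)
    (hsymm : ∀ x y : V, B x y = B y x)
    (hpos : ∀ x : V, x ≠ 0 → 0 < B x x)
    (hcompat : ∀ (a : F₀) (x y : V), B (a • x) y = B x (σ a • y))
    (W : Submodule ℂ (ℂ ⊗[ℚ] V))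
    (hWdim : Module.finrank ℂ W = n)
    (hisot : ∀ x ∈ W, ∀ y ∈ W, B.baseChange ℂ x y = 0)
    (hstable : ∀ (a : F₀), ∀ w ∈ W, actionC F₀ V a w ∈ W)
    (htype : ∀ τ : F₀ →+* ℂ, Module.finrank ℂ ↥(W ⊓ eigenspaceC F₀ V τ) = 1) :
    ∃ (ψ : V →ₗ[ℚ] V) (c : F₀),
      σ c = c ∧
      (∀ ρ : F₀ →+* ℂ, (ρ c).re < 0 ∧ (ρ c).im = 0) ∧
      (∀ (a : F₀) (x : V), ψ (a • x) = σ a • ψ x) ∧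
      (∀ x : V, ψ (ψ x) = c • x) ∧
      (∀ w ∈ W, ψ.baseChange ℂ w ∈ W) := by
  have hnon : B.Nondegenerate := by
    refine ⟨fun x hx => ?_, fun x hx => ?_⟩ <;> by_contra h <;> exact (hpos x h).ne' (hx x)
  obtain ⟨ψ, c, hc, hcneg, hψ, hψψ, halt⟩ :=
    NumberField.exists_conjLinear_alternating σ hσ hdimV hnon hsymm hpos hcompat
  have hσσ (a : F₀) : σ (σ a) = a := by
    obtain ⟨ρ⟩ : Nonempty (F₀ →+* ℂ) := inferInstance
    apply ρ.injective
    rw [hσ, hσ, Complex.conj_conj]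
  exact ⟨ψ, c, hc, hcneg, hψ, hψψ, fun w hw => baseChange_mem_of_conjLinear_alternating σ hdimV
    hnon hsymm hcompat (hWdim.trans hdeg.symm) hisot htype hσσ hψ halt hw⟩
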